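/- arXiv:2304.02539 — 2 statements merged into one kernel-verified Lean document; each statement's English description precedes it below -/
import Mathlib

section
/- Let M ≥ 1 annotators be partitioned into G ∈ {1,…,M} non-empty, pairwise disjoint groups A^{(1)}, …, A^{(G)} with A^{(1)} ∪ … ∪ A^{(G)} = {1,…,M}. Let N ≥ 1 and suppose that for each instance index n ∈ {1,…,N} and each annotator m ∈ {1,…,M} there is a positive probability value P_{nm} ∈ (0,1] (the probability Pr(z_{nm} | x_n, a_m) of the observed annotation), such that within each group the values coincide: for all g and all m, l ∈ A^{(g)}, P_{nm} = P_{nl} for every n. Suppose the annotator densities satisfy Pr(a_m) = c · |A^{(g(m))}| for some constant c > 0, where g(m) is the group containing m, and define the weights w(a_m) := Pr(a_m)^{-1} / Z with Z := M^{-1} Σ_{l=1}^M Pr(a_l)^{-1}. Then for any choice of representatives m_g ∈ A^{(g)} (g = 1,…,G): Σ_{n=1}^N Σ_{m=1}^M w(a_m)·ln(P_{nm}) = (M/G) · Σ_{n=1}^N Σ_{g=1}^G ln(P_{n m_g}). In particular, the weighted log-likelihood for all M annotators is proportional to the unweighted log-likelihood for G representative annotators, one per group. -/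
/-- Over a partition into nonempty blocks, summing a blockwise constant function against
inverse densities proportional to block sizes counts each block once. -/
theorem sum_inv_density_mul_eq_sum_representatives {ι κ : Type*} [Fintype ι] [Fintype κ]
    (A : κ → Finset ι) (hdisj : ∀ g g', g ≠ g' → Disjoint (A g) (A g'))
    (hcover : ∀ m, ∃ g, m ∈ A g) (p : ι → ℝ) (c : ℝ)
    (hp : ∀ g, ∀ m ∈ A g, p m = c * (A g).card)
    (rep : κ → ι) (hrep : ∀ g, rep g ∈ A g)
    (f : ι → ℝ) (hf : ∀ g, ∀ m ∈ A g, f m = f (rep g)) :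
    ∑ m, (p m)⁻¹ * f m = c⁻¹ * ∑ g, f (rep g) := by
  classical
  have huniv : (Finset.univ : Finset ι) = Finset.univ.biUnion A := by
    ext m
    simpa using hcover m
  rw [huniv, Finset.sum_biUnion fun g _ g' _ h => hdisj g g' h, Finset.mul_sum]
  refine Finset.sum_congr rfl fun g _ => ?_
  have hcard : ((A g).card : ℝ) ≠ 0 :=
    Nat.cast_ne_zero.mpr (Finset.card_ne_zero_of_mem (hrep g))
  rw [Finset.sum_congr rfl fun m hm => by rw [hp g m hm, hf g m hm], Finset.sum_const,
    nsmul_eq_mul, mul_inv]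
  field_simp

/-- Theorem 1: with annotator groups sharing identical annotation probabilities,
densities proportional to group cardinalities, and inverse-density weights, the
weighted log-likelihood over all `M` annotators equals `M/G` times the
log-likelihood over `G` group representatives. -/
theorem weighted_loglik_reduces_to_groups
    (M N G : ℕ) (hM : 1 ≤ M) (hN : 1 ≤ N) (hG1 : 1 ≤ G) (hGM : G ≤ M)
    (A : Fin G → Finset (Fin M))
    (hne : ∀ g, (A g).Nonempty)
    (hdisj : ∀ g g', g ≠ g' → Disjoint (A g) (A g'))
    (hcover : ∀ m : Fin M, ∃ g, m ∈ A g)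
    (P : Fin N → Fin M → ℝ)
    (hP0 : ∀ n m, 0 < P n m) (hP1 : ∀ n m, P n m ≤ 1)
    (hPgroup : ∀ g, ∀ m ∈ A g, ∀ l ∈ A g, ∀ n : Fin N, P n m = P n l)
    (Pr : Fin M → ℝ) (c : ℝ) (hc : 0 < c)
    (hPr : ∀ g, ∀ m ∈ A g, Pr m = c * (A g).card)
    (Z : ℝ) (hZ : Z = (M : ℝ)⁻¹ * ∑ l, (Pr l)⁻¹)
    (w : Fin M → ℝ) (hw : ∀ m, w m = (Pr m)⁻¹ / Z)
    (rep : Fin G → Fin M) (hrep : ∀ g, rep g ∈ A g) :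
    ∑ n, ∑ m, w m * Real.log (P n m) =
      ((M : ℝ) / (G : ℝ)) * ∑ n, ∑ g, Real.log (P n (rep g)) := by
  have hsum := sum_inv_density_mul_eq_sum_representatives A hdisj hcover Pr c hPr rep hrep
  have hZ' : Z = (M : ℝ)⁻¹ * (c⁻¹ * G) := by
    rw [hZ]
    congr 1
    simpa using hsum (fun _ => 1) fun _ _ _ => rfl
  have hM0 : (M : ℝ) ≠ 0 := by positivity
  have hG0 : (G : ℝ) ≠ 0 := by positivity
  rw [Finset.mul_sum]
  refine Finset.sum_congr rfl fun n _ => ?_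
  calc ∑ m, w m * Real.log (P n m) = Z⁻¹ * ∑ m, (Pr m)⁻¹ * Real.log (P n m) := by
        rw [Finset.mul_sum]
        refine Finset.sum_congr rfl fun m _ => ?_
        rw [hw]
        ring
    _ = Z⁻¹ * (c⁻¹ * ∑ g, Real.log (P n (rep g))) := by
        rw [hsum (fun m => Real.log (P n m)) fun g m hm => by
          rw [hPgroup g m hm (rep g) (hrep g) n]]
    _ = (M : ℝ) / G * ∑ g, Real.log (P n (rep g)) := by
        rw [hZ']
        field_simp
end

section
/- Let M ≥ 1 annotators be partitioned into G ∈ {1,…,M} non-empty, pairwise disjoint groups A^{(1)}, …, A^{(G)} with A^{(1)} ∪ … ∪ A^{(G)} = {1,…,M}, and suppose the annotator densities satisfy Pr(a_m) = c · |A^{(g(m))}| for some constant c > 0, where g(m) denotes the group containing m. Define w(a_m) := Pr(a_m)^{-1}/Z with Z := M^{-1} Σ_{l=1}^M Pr(a_l)^{-1}. Then the sums of the annotator weights are uniformly distributed across the G groups: Σ_{m ∈ A^{(1)}} w(a_m) = Σ_{m ∈ A^{(2)}} w(a_m) = … = Σ_{m ∈ A^{(G)}} w(a_m) = M/G. -/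
/-- Claim (◇) from the proof of Theorem 1: with densities proportional to group
cardinalities, the total annotator weight of every group equals `M/G`. -/
theorem group_weight_sums_uniform
    (M G : ℕ) (hM : 1 ≤ M) (hG1 : 1 ≤ G) (hGM : G ≤ M)
    (A : Fin G → Finset (Fin M))
    (hne : ∀ g, (A g).Nonempty)
    (hdisj : ∀ g g', g ≠ g' → Disjoint (A g) (A g'))
    (hcover : ∀ m : Fin M, ∃ g, m ∈ A g)
    (Pr : Fin M → ℝ) (c : ℝ) (hc : 0 < c)
    (hPr : ∀ g, ∀ m ∈ A g, Pr m = c * (A g).card)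
    (Z : ℝ) (hZ : Z = (M : ℝ)⁻¹ * ∑ l, (Pr l)⁻¹)
    (w : Fin M → ℝ) (hw : ∀ m, w m = (Pr m)⁻¹ / Z) :
    ∀ g, ∑ m ∈ A g, w m = (M : ℝ) / (G : ℝ) := by
  have hgroup : ∀ g, ∑ m ∈ A g, (Pr m)⁻¹ = c⁻¹ := by
    intro g
    have hcard : ((A g).card : ℝ) ≠ 0 := by
      exact_mod_cast (hne g).card_pos.ne'
    rw [Finset.sum_congr rfl fun m hm => by rw [hPr g m hm], Finset.sum_const, nsmul_eq_mul]
    field_simp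
  have hunion : (Finset.univ : Finset (Fin M)) = Finset.univ.biUnion A := by
    ext m
    simpa using hcover m
  have htotal : ∑ l, (Pr l)⁻¹ = G * c⁻¹ := by
    rw [hunion, Finset.sum_biUnion fun g _ g' _ h => hdisj g g' h]
    simp [hgroup]
  have hM0 : (M : ℝ) ≠ 0 := by exact_mod_cast (by omega : M ≠ 0)
  have hG0 : (G : ℝ) ≠ 0 := by exact_mod_cast (by omega : G ≠ 0)
  intro g
  simp only [hw]
  rw [← Finset.sum_div, hgroup, hZ, htotal]
  field_simp
end
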